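/- Let q ≥ 3 be an odd integer with 3 ∤ (q+1), and let x be an even integer with 1 ≤ x ≤ q. Then x occurs in exactly (q−3)/2 triples of T. -/

import Mathlib

open Finset

/-- The set of triples `(k,l,m)` of integers with `1 ≤ k < l < m ≤ q+1` and
`k + l + m ≡ 0 (mod q+1)`. -/
def T (q : ℕ) : Finset (ℕ × ℕ × ℕ) :=
  (Finset.Icc 1 (q+1) ×ˢ Finset.Icc 1 (q+1) ×ˢ Finset.Icc 1 (q+1)).filter
    (fun t => t.1 < t.2.1 ∧ t.2.1 < t.2.2 ∧ (q+1) ∣ (t.1 + t.2.1 + t.2.2))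

/-- The number of triples of `T q` in which the integer `x` occurs. -/
def occ (q x : ℕ) : ℕ :=
  ((T q).filter (fun t => t.1 = x ∨ t.2.1 = x ∨ t.2.2 = x)).card

/-- A triple of `T (2 * n - 1)` has sum `2 * n` or `4 * n`. -/
theorem mem_T_iff_of_succ_eq {q n k l m : ℕ} (hn : q + 1 = 2 * n) :
    (k, l, m) ∈ T q ↔ 1 ≤ k ∧ k < l ∧ l < m ∧ m ≤ 2 * n ∧
      (k + l + m = 2 * n ∨ k + l + m = 4 * n) := by
  simp only [T, mem_filter, mem_product, mem_Icc, hn]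
  constructor
  · rintro ⟨⟨hk, hl, hm⟩, hkl, hlm, c, hc⟩
    have hc3 : c < 3 := by
      by_contra! h
      have := Nat.mul_le_mul_left (2 * n) h
      omega
    interval_cases c <;> omega
  · rintro ⟨hk, hkl, hlm, hm, h | h⟩
    · exact ⟨by omega, hkl, hlm, 1, by omega⟩
    · exact ⟨by omega, hkl, hlm, 2, by omega⟩

/-- The smaller of `2 * y` and the residue of `-4 * y` modulo `2 * n` in `[1, 2 * n]`. -/
def excludedResidue (n y : ℕ) : ℕ :=
  if 2 * y < n then min (2 * y) (2 * n - 4 * y) else min (2 * y) (4 * n - 4 * y)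

/-- The smaller members `a` of the pairs `{a, b}` completing `2 * y` to a triple of distinct
residues with sum zero modulo `2 * n`. -/
def smallerPartners (n y : ℕ) : Finset ℕ :=
  (Ico 1 (n - y) ∪ Ico (2 * n - 2 * y) (2 * n - y)).erase (excludedResidue n y)

theorem card_smallerPartners {n y : ℕ} (h3 : ¬ 3 ∣ n) (hy : 1 ≤ y) (hyn : y < n) :
    (smallerPartners n y).card = n - 2 := by
  rw [smallerPartners, card_erase_of_mem, card_union_of_disjoint, Nat.card_Ico, Nat.card_Ico]
  · omega
  · rw [disjoint_left]
    intro a ha hb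
    rw [mem_Ico] at ha hb
    omega
  · simp only [mem_union, mem_Ico, excludedResidue]
    split_ifs <;> omega

theorem occ_eq_card_smallerPartners {q n y : ℕ} (hn : q + 1 = 2 * n)
    (hy : 1 ≤ y) (hyn : y < n) : occ q (2 * y) = (smallerPartners n y).card := by
  unfold occ
  refine card_bij (fun t _ => if t.1 = 2 * y then t.2.1 else t.1) ?_ ?_ ?_
  · rintro ⟨k, l, m⟩ ht
    rw [mem_filter, mem_T_iff_of_succ_eq hn] at ht
    simp only [smallerPartners, mem_erase, mem_union, mem_Ico, excludedResidue]
    dsimp only at ht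
    split_ifs <;> omega
  · rintro ⟨k, l, m⟩ ht ⟨k', l', m'⟩ ht' h
    rw [mem_filter, mem_T_iff_of_succ_eq hn] at ht ht'
    simp only [Prod.mk.injEq]
    dsimp only at ht ht' h
    split_ifs at h <;> omega
  · intro a ha
    simp only [smallerPartners, mem_erase, mem_union, mem_Ico, excludedResidue] at ha
    obtain ⟨b, hab, hb, hsum⟩ : ∃ b, a < b ∧ b ≤ 2 * n ∧
        (2 * y + a + b = 2 * n ∨ 2 * y + a + b = 4 * n) := by
      by_cases h : a < n - y
      · exact ⟨2 * n - 2 * y - a, by omega, by omega, by omega⟩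
      · exact ⟨4 * n - 2 * y - a, by omega, by omega, by omega⟩
    have hne : a ≠ 2 * y ∧ b ≠ 2 * y := by
      split_ifs at ha <;> omega
    have key : ∀ k l m, (k, l, m) ∈ T q → (k = 2 * y ∨ l = 2 * y ∨ m = 2 * y) →
        (if k = 2 * y then l else k) = a →
        ∃ t, ∃ _ : t ∈ (T q).filter (fun t => t.1 = 2 * y ∨ t.2.1 = 2 * y ∨ t.2.2 = 2 * y),
          (if t.1 = 2 * y then t.2.1 else t.1) = a :=
      fun k l m hT hx h => ⟨(k, l, m), mem_filter.mpr ⟨hT, hx⟩, h⟩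
    rcases lt_or_gt_of_ne hne.1 with h1 | h1
    · rcases lt_or_gt_of_ne hne.2 with h2 | h2
      · exact key a b (2 * y) ((mem_T_iff_of_succ_eq hn).mpr (by omega)) (by simp)
          (if_neg hne.1)
      · exact key a (2 * y) b ((mem_T_iff_of_succ_eq hn).mpr (by omega)) (by simp)
          (if_neg hne.1)
    · exact key (2 * y) a b ((mem_T_iff_of_succ_eq hn).mpr (by omega)) (by simp) (if_pos rfl)

theorem stmt_4 (q : ℕ) (hq : 3 ≤ q) (hodd : Odd q) (h3 : ¬ (3 ∣ (q+1)))
    (x : ℕ) (hx1 : 1 ≤ x) (hxq : x ≤ q) (hxeven : Even x) :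
    occ q x = (q - 3) / 2 := by
  obtain ⟨p, rfl⟩ := hodd
  obtain ⟨y, rfl⟩ := hxeven
  have hn : 2 * p + 1 + 1 = 2 * (p + 1) := by ring
  have h3' : ¬ 3 ∣ p + 1 := by omega
  rw [← two_mul, occ_eq_card_smallerPartners hn (by omega) (by omega),
    card_smallerPartners h3' (by omega) (by omega)]
  omega
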